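/- arXiv:2508.13890 — 2 statements merged into one kernel-verified Lean document; each statement's English description precedes it below -/
import Mathlib

section
/- Suppose β̂ ∈ ℝ^p is a minimizer of the lasso objective L(β) = (2n)⁻¹‖ỹ − Zβ‖₂² + λ‖β‖₁ with an associated subgradient vector ũ satisfying n⁻¹ZᵀZ β̂ − n⁻¹Zᵀỹ + λũ = 0 and the strict dual feasibility condition |ũ_j| < 1 for all j ∉ supp(β̂). Then every other minimizer β̃ of L satisfies β̃_j = 0 for all j ∉ supp(β̂). -/
open Finset Matrix

/-- The lasso objective `L(β) = (2n)⁻¹‖ỹ − Zβ‖₂² + λ‖β‖₁`. -/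
noncomputable def lassoObj {n p : ℕ} (Z : Matrix (Fin n) (Fin p) ℝ)
    (ytil : Fin n → ℝ) (lam : ℝ) (β : Fin p → ℝ) : ℝ :=
  (2 * (n : ℝ))⁻¹ * ∑ i, (ytil i - Z.mulVec β i) ^ 2 + lam * ∑ j, |β j|

/-- `u` is a subgradient vector of the ℓ₁-norm at `βhat`. -/
def IsL1Subgrad {p : ℕ} (βhat u : Fin p → ℝ) : Prop :=
  ∀ j, (βhat j ≠ 0 → u j = Real.sign (βhat j)) ∧ (βhat j = 0 → |u j| ≤ 1)

/-- if β̂ minimizes the lasso objective with an associated subgradient vector ũ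
satisfying the stationarity equation and strict dual feasibility `|ũ_j| < 1` for all
`j ∉ supp(β̂)`, then every other minimizer β̃ satisfies `β̃_j = 0` for all `j ∉ supp(β̂)`. -/
theorem lasso_strict_dual_feasibility_zero_off_support {n p : ℕ} (hn : 0 < n)
    (Z : Matrix (Fin n) (Fin p) ℝ) (ytil : Fin n → ℝ)
    (lam : ℝ) (hlam : 0 < lam) (βhat u : Fin p → ℝ)
    (hmin : ∀ β : Fin p → ℝ, lassoObj Z ytil lam βhat ≤ lassoObj Z ytil lam β)
    (hsub : IsL1Subgrad βhat u)
    (hstat : (n : ℝ)⁻¹ • (Zᵀ * Z).mulVec βhat - (n : ℝ)⁻¹ • Zᵀ.mulVec ytil + lam • u = 0)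
    (hstrict : ∀ j, βhat j = 0 → |u j| < 1) :
    ∀ βtil : Fin p → ℝ,
      (∀ β : Fin p → ℝ, lassoObj Z ytil lam βtil ≤ lassoObj Z ytil lam β) →
      ∀ j, βhat j = 0 → βtil j = 0 := by
  intro βtil ht
  have hnR : (0 : ℝ) < n := by exact_mod_cast hn
  have hle := ht βhat
  set d : Fin p → ℝ := βtil - βhat with hd
  -- pair the stationarity equation with the difference `d`
  have key : ∑ i, (ytil i - Z.mulVec βhat i) * Z.mulVec d i = n * lam * ∑ j, u j * d j := by
    have h1 : (n : ℝ)⁻¹ * (Z.mulVec βhat ⬝ᵥ Z.mulVec d) - (n : ℝ)⁻¹ * (ytil ⬝ᵥ Z.mulVec d)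
        + lam * (u ⬝ᵥ d) = 0 := by
      have h := congrArg (fun v => v ⬝ᵥ d) hstat
      simp only [add_dotProduct, sub_dotProduct, smul_dotProduct, zero_dotProduct,
        smul_eq_mul] at h
      rw [← Matrix.mulVec_mulVec, Matrix.mulVec_transpose, Matrix.mulVec_transpose,
        ← Matrix.dotProduct_mulVec, ← Matrix.dotProduct_mulVec] at h
      exact h
    have h2 : ∑ i, (ytil i - Z.mulVec βhat i) * Z.mulVec d i
        = ytil ⬝ᵥ Z.mulVec d - Z.mulVec βhat ⬝ᵥ Z.mulVec d := by
      simp only [dotProduct, sub_mul, Finset.sum_sub_distrib]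
    have h3 : ∑ j, u j * d j = u ⬝ᵥ d := rfl
    rw [h2, h3]
    field_simp at h1
    linarith
  have hquad : ∑ i, (ytil i - Z.mulVec βtil i) ^ 2
      = ∑ i, (ytil i - Z.mulVec βhat i) ^ 2
        - 2 * ∑ i, (ytil i - Z.mulVec βhat i) * Z.mulVec d i + ∑ i, (Z.mulVec d i) ^ 2 := by
    rw [Finset.mul_sum, ← Finset.sum_sub_distrib, ← Finset.sum_add_distrib]
    refine Finset.sum_congr rfl fun i _ => ?_
    rw [hd, Matrix.mulVec_sub, Pi.sub_apply]
    ring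
  have hsq : 0 ≤ ∑ i, (Z.mulVec d i) ^ 2 := Finset.sum_nonneg fun i _ => sq_nonneg _
  have hu : ∀ j, |u j| ≤ 1 := by
    intro j
    by_cases h : βhat j = 0
    · exact (hsub j).2 h
    · rw [(hsub j).1 h]
      rcases lt_or_gt_of_ne h with h | h
      · simp [Real.sign_of_neg h]
      · simp [Real.sign_of_pos h]
  have hub : ∀ j, u j * βhat j = |βhat j| := by
    intro j
    by_cases h : βhat j = 0
    · simp [h]
    · rw [(hsub j).1 h]
      rcases lt_or_gt_of_ne h with h | h
      · simp [Real.sign_of_neg h, abs_of_neg h]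
      · simp [Real.sign_of_pos h, abs_of_pos h]
  have hterm : ∀ j, 0 ≤ |βtil j| - u j * βtil j := by
    intro j
    have h1 : u j * βtil j ≤ |u j| * |βtil j| := by
      rw [← abs_mul]; exact le_abs_self _
    have h2 := mul_le_mul_of_nonneg_right (hu j) (abs_nonneg (βtil j))
    linarith
  have hud : ∑ j, u j * d j = ∑ j, u j * βtil j - ∑ j, |βhat j| := by
    rw [← Finset.sum_sub_distrib]
    refine Finset.sum_congr rfl fun j _ => ?_
    rw [hd, Pi.sub_apply, mul_sub, hub]
  have hsum : ∑ j, (|βtil j| - u j * βtil j) ≤ 0 := by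
    rw [Finset.sum_sub_distrib]
    unfold lassoObj at hle
    rw [hquad, key, hud] at hle
    set A := ∑ i, (ytil i - Z.mulVec βhat i) ^ 2
    set B := ∑ i, (Z.mulVec d i) ^ 2
    set C := ∑ j, u j * βtil j
    set D := ∑ j, |βhat j|
    set E := ∑ j, |βtil j|
    have e : (2 * (n : ℝ))⁻¹ * (A - 2 * (n * lam * (C - D)) + B)
        = (2 * (n : ℝ))⁻¹ * A - lam * (C - D) + (2 * (n : ℝ))⁻¹ * B := by
      field_simp
    rw [e] at hle
    have hB : 0 ≤ (2 * (n : ℝ))⁻¹ * B := by positivity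
    have : lam * (E - C) ≤ 0 := by linarith
    by_contra hc
    have := mul_pos hlam (not_le.mp hc)
    linarith
  intro j hj
  have hz : |βtil j| - u j * βtil j ≤ 0 :=
    (Finset.single_le_sum (f := fun j => |βtil j| - u j * βtil j)
      (fun i _ => hterm i) (Finset.mem_univ j)).trans hsum
  by_contra hne
  have h1 : u j * βtil j ≤ |u j| * |βtil j| := by
    rw [← abs_mul]; exact le_abs_self _
  have h2 := mul_lt_mul_of_pos_right (hstrict j hj) (abs_pos.mpr hne)
  linarith
end

section
/- Suppose β̂ ∈ ℝ^p is a minimizer of the lasso objective L(β) = (2n)⁻¹‖ỹ − Zβ‖₂² + λ‖β‖₁ with an associated subgradient vector ũ satisfying n⁻¹ZᵀZ β̂ − n⁻¹Zᵀỹ + λũ = 0 and |ũ_j| < 1 for all j ∉ supp(β̂). If in addition the Gram submatrix Z_{supp(β̂)}ᵀ Z_{supp(β̂)}, formed from the columns of Z indexed by supp(β̂), is invertible, then β̂ is the unique minimizer of L. -/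
open Finset Matrix

/-- The submatrix of columns of `Z` indexed by the support of `βhat`. -/
noncomputable def suppCols {n p : ℕ} (Z : Matrix (Fin n) (Fin p) ℝ) (βhat : Fin p → ℝ) :
    Matrix (Fin n) {j : Fin p // βhat j ≠ 0} ℝ :=
  Z.submatrix id (fun j => (j : Fin p))

/-- if β̂ minimizes the lasso objective with an associated subgradient vector ũ
satisfying the stationarity equation and strict dual feasibility off the support of β̂, and
the Gram submatrix `Z_{supp(β̂)}ᵀ Z_{supp(β̂)}` is invertible, then β̂ is the unique minimizer. -/
theorem lasso_strict_dual_feasibility_unique {n p : ℕ} (hn : 0 < n)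
    (Z : Matrix (Fin n) (Fin p) ℝ) (ytil : Fin n → ℝ)
    (lam : ℝ) (hlam : 0 < lam) (βhat u : Fin p → ℝ)
    (hmin : ∀ β : Fin p → ℝ, lassoObj Z ytil lam βhat ≤ lassoObj Z ytil lam β)
    (hsub : IsL1Subgrad βhat u)
    (hstat : (n : ℝ)⁻¹ • (Zᵀ * Z).mulVec βhat - (n : ℝ)⁻¹ • Zᵀ.mulVec ytil + lam • u = 0)
    (hstrict : ∀ j, βhat j = 0 → |u j| < 1)
    (hinv : IsUnit ((suppCols Z βhat)ᵀ * suppCols Z βhat)) :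
    ∀ βtil : Fin p → ℝ,
      (∀ β : Fin p → ℝ, lassoObj Z ytil lam βtil ≤ lassoObj Z ytil lam β) →
      βtil = βhat := by
  intro b hb
  have hn' : (n : ℝ) ≠ 0 := by positivity
  have hn0 : (0 : ℝ) < n := by positivity
  set d : Fin p → ℝ := b - βhat with hd
  set r : Fin n → ℝ := ytil - Z *ᵥ βhat with hr
  have hZr : Zᵀ *ᵥ r = ((n : ℝ) * lam) • u := by
    rw [hr, mulVec_sub, mulVec_mulVec]
    ext j
    have h := congrFun hstat j
    simp only [Pi.add_apply, Pi.sub_apply, Pi.smul_apply, smul_eq_mul, Pi.zero_apply] at h ⊢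
    field_simp at h
    linarith
  have hcross : ∑ i, r i * (Z *ᵥ d) i = (n : ℝ) * lam * ∑ j, u j * d j := by
    have h1 : r ⬝ᵥ (Z *ᵥ d) = (((n : ℝ) * lam) • u) ⬝ᵥ d := by
      rw [← hZr, dotProduct_mulVec, mulVec_transpose]
    rw [smul_dotProduct] at h1
    simpa [dotProduct] using h1
  have hsq : ∑ i, (ytil i - (Z *ᵥ b) i) ^ 2 = ∑ i, (ytil i - (Z *ᵥ βhat) i) ^ 2
      - 2 * ((n : ℝ) * lam * ∑ j, u j * d j) + ∑ i, ((Z *ᵥ d) i) ^ 2 := by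
    rw [← hcross, Finset.mul_sum, ← Finset.sum_sub_distrib, ← Finset.sum_add_distrib]
    refine Finset.sum_congr rfl fun i _ => ?_
    simp only [hr, hd, mulVec_sub, Pi.sub_apply]
    ring
  have hu1 : ∀ j, |u j| ≤ 1 := by
    intro j
    by_cases h : βhat j = 0
    · exact (hsub j).2 h
    · rw [(hsub j).1 h]
      rcases lt_or_gt_of_ne h with h | h
      · simp [Real.sign_of_neg h]
      · simp [Real.sign_of_pos h]
  have hub : ∀ j, u j * βhat j = |βhat j| := by
    intro j
    by_cases h : βhat j = 0
    · simp [h]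
    · rw [(hsub j).1 h]
      rcases lt_or_gt_of_ne h with h | h
      · simp [Real.sign_of_neg h, abs_of_neg h]
      · simp [Real.sign_of_pos h, abs_of_pos h]
  have hgap : ∀ j, 0 ≤ |b j| - u j * b j := by
    intro j
    have h1 : u j * b j ≤ |u j| * |b j| := by rw [← abs_mul]; exact le_abs_self _
    nlinarith [hu1 j, abs_nonneg (b j)]
  have hud : ∑ j, u j * d j = ∑ j, |b j| - ∑ j, |βhat j| - ∑ j, (|b j| - u j * b j) := by
    rw [← Finset.sum_sub_distrib, ← Finset.sum_sub_distrib]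
    refine Finset.sum_congr rfl fun j _ => ?_
    rw [← hub j]
    simp only [hd, Pi.sub_apply]
    ring
  have hle := hb βhat
  unfold lassoObj at hle
  rw [hsq, hud] at hle
  have hG0 : 0 ≤ ∑ j, (|b j| - u j * b j) := Finset.sum_nonneg fun j _ => hgap j
  have hQ0 : 0 ≤ ∑ i, ((Z *ᵥ d) i) ^ 2 := Finset.sum_nonneg fun i _ => sq_nonneg _
  have hkey : (2 * (n : ℝ))⁻¹ * ∑ i, ((Z *ᵥ d) i) ^ 2
      + lam * ∑ j, (|b j| - u j * b j) ≤ 0 := by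
    generalize ∑ j, (|b j| - u j * b j) = G at *
    generalize ∑ i, ((Z *ᵥ d) i) ^ 2 = Q at *
    generalize ∑ i, (ytil i - (Z *ᵥ βhat) i) ^ 2 = R at *
    field_simp at hle ⊢
    nlinarith
  have hc : 0 < (2 * (n : ℝ))⁻¹ := by positivity
  have hQ : ∑ i, ((Z *ᵥ d) i) ^ 2 = 0 := by
    have := mul_nonneg hlam.le hG0
    have := mul_nonneg hc.le hQ0
    exact (mul_eq_zero.1 (by linarith : (2 * (n : ℝ))⁻¹ * ∑ i, ((Z *ᵥ d) i) ^ 2 = 0)).resolve_left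
      hc.ne'
  have hG : ∑ j, (|b j| - u j * b j) = 0 := by
    have := mul_nonneg hlam.le hG0
    have := mul_nonneg hc.le hQ0
    exact (mul_eq_zero.1 (by linarith : lam * ∑ j, (|b j| - u j * b j) = 0)).resolve_left
      hlam.ne'
  have hZd : Z *ᵥ d = 0 := by
    ext i
    have := (Finset.sum_eq_zero_iff_of_nonneg fun i _ => sq_nonneg _).1 hQ i (Finset.mem_univ i)
    simpa using this
  have hoff : ∀ j, βhat j = 0 → d j = 0 := by
    intro j hj
    have h0 := (Finset.sum_eq_zero_iff_of_nonneg fun j _ => hgap j).1 hG j (Finset.mem_univ j)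
    have h1 : u j * b j ≤ |u j| * |b j| := by rw [← abs_mul]; exact le_abs_self _
    have h2 : b j = 0 := by
      by_contra hne
      have := abs_pos.2 hne
      nlinarith [hstrict j hj]
    simp [hd, h2, hj]
  let dS : {j : Fin p // βhat j ≠ 0} → ℝ := fun j => d j
  have hS : suppCols Z βhat *ᵥ dS = 0 := by
    rw [← hZd]
    ext i
    simp only [mulVec, dotProduct, suppCols, submatrix_apply, id, dS]
    rw [← Fintype.sum_subtype_add_sum_subtype (fun j => βhat j ≠ 0) (fun j => Z i j * d j)]
    rw [left_eq_add]
    refine Finset.sum_eq_zero fun j _ => ?_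
    rw [hoff j (not_not.1 j.2), mul_zero]
  have hdS : dS = 0 := by
    apply mulVec_injective_of_isUnit hinv
    simp only [mulVec_zero]
    rw [← mulVec_mulVec, hS, mulVec_zero]
  have hd0 : d = 0 := by
    ext j
    by_cases h : βhat j = 0
    · exact hoff j h
    · exact congrFun hdS ⟨j, h⟩
  exact sub_eq_zero.1 hd0
end
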